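/- Let k ≥ 1 and write P_k ≅ P(i)^{⊕c_k} ⊕ Q_k, where Q_k has no direct summand isomorphic to P(i). Then for each 1 ≤ l ≤ c_k there exists a chain map f_l : P• → P•[k] whose degree-k component is f_l^{(k)} = [π_l, 0] : P(i)^{⊕c_k} ⊕ Q_k → P(i) = P_0 (π_l the canonical projection onto the l-th copy of P(i)), and the classes of f_1,…,f_{c_k} modulo null-homotopic chain maps form a K-basis of Ext^k_A(Δ̄(i),Δ̄(i)); in particular dim_K Ext^k_A(Δ̄(i),Δ̄(i)) = c_k, the multiplicity of P(i) as a direct summand of P_k. -/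

import Mathlib

/-!
STATEMENT 4 (part 1 of Lemma "basis of Ext" of the paper).

Setting as in the paper: `K` algebraically closed, `A` a finite-dimensional `K`-algebra with
a complete set of pairwise orthogonal primitive idempotents; `P(i) = Ae_i`, `rad A` is the
intersection of the maximal left ideals, and the properly standard module `Δ̄(i)` is
`P(i)/U(i)`.  `P•` is a minimal projective resolution of `Δ̄(i)` with `P_0 ≅ P(i)`, each
`P_k` a finite direct sum of modules `P(j)` with `j ≥ i`, and radical differentials.

For `k = k' + 1 ≥ 1`, chain maps `g : P• → P•[k]` are encoded by their components
`g m := g^{(m+k)} : P (k'+m+1) →ₗ[A] P m` (`chainCond`), null-homotopic ones by `nullCond`,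
and `Ext^k_A(Δ̄(i),Δ̄(i))` is the `K`-vector space of chain maps modulo null-homotopic ones
(`extK`; the sets of chain maps and of null-homotopic maps are `K`-subspaces, so taking
`K`-spans does not change them).
-/

noncomputable section

def mulRightLin (A : Type*) [Ring A] (a : A) : A →ₗ[A] A where
  toFun x := x * a
  map_add' x y := add_mul x y a
  map_smul' r x := by simp [smul_eq_mul, mul_assoc]

def leftIdeal (A : Type*) [Ring A] (a : A) : Submodule A A := LinearMap.range (mulRightLin A a)

def jacRad (A : Type*) [Ring A] : Ideal A := sInf {I : Ideal A | I.IsMaximal}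

def radM (A : Type*) [Ring A] (M : Type*) [AddCommGroup M] [Module A M] : Submodule A M :=
  Submodule.span A {x | ∃ r ∈ jacRad A, ∃ m : M, x = r • m}

def IsRadHom (A : Type*) [Ring A] {M N : Type*} [AddCommGroup M] [Module A M]
    [AddCommGroup N] [Module A N] (f : M →ₗ[A] N) : Prop :=
  LinearMap.range f ≤ radM A N

def IsPrimitiveIdem (A : Type*) [Ring A] (x : A) : Prop :=
  IsIdempotentElem x ∧ x ≠ 0 ∧ ∀ y z : A, IsIdempotentElem y → IsIdempotentElem z →
    y * z = 0 → z * y = 0 → x = y + z → y = 0 ∨ z = 0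

def properU (A : Type*) [Ring A] {n : ℕ} (e : Fin n → A) (i : Fin n) :
    Submodule A ↥(leftIdeal A (e i)) :=
  ⨆ (j : Fin n) (_ : i ≤ j) (φ : ↥(leftIdeal A (e j)) →ₗ[A] ↥(leftIdeal A (e i)))
    (_ : IsRadHom A φ), LinearMap.range φ

abbrev PStd (A : Type*) [Ring A] {n : ℕ} (e : Fin n → A) (i : Fin n) :=
  ↥(leftIdeal A (e i)) ⧸ properU A e i

section ChainMaps

variable {A : Type*} [Ring A] (K : Type*) [Field K] [Algebra K A]
  (P : ℕ → Type*) [∀ l, AddCommGroup (P l)] [∀ l, Module A (P l)]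
  [∀ l, Module K (P l)] [∀ l, IsScalarTower K A (P l)] [∀ l, SMulCommClass A K (P l)]
  (dP : ∀ l, P (l + 1) →ₗ[A] P l) (k' : ℕ)

/-- the chain-map condition for a degree-`(k'+1)` element of `Hom_A(P•,P•[k'+1])` -/
def chainCond (g : ∀ m, P (k' + m + 1) →ₗ[A] P m) : Prop :=
  ∀ m, (g m) ∘ₗ (dP (k' + m + 1)) = ((-1 : ℤ) ^ (k' + 1)) • ((dP m) ∘ₗ (g (m + 1)))

/-- the null-homotopy condition -/
def nullCond (g : ∀ m, P (k' + m + 1) →ₗ[A] P m) : Prop :=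
  ∃ h : ∀ m, P (k' + m) →ₗ[A] P m,
    ∀ m, g m = ((dP m) ∘ₗ (h (m + 1)) : P (k' + m + 1) →ₗ[A] P m) -
      ((-1 : ℤ) ^ k') • ((h m) ∘ₗ (dP (k' + m)))

/-- the space of degree-`(k'+1)` chain maps (a `K`-subspace) -/
def chainS : Submodule K (∀ m, P (k' + m + 1) →ₗ[A] P m) :=
  Submodule.span K {g | chainCond P dP k' g}

/-- the space of null-homotopic maps (a `K`-subspace) -/
def nullS : Submodule K (∀ m, P (k' + m + 1) →ₗ[A] P m) :=
  Submodule.span K {g | nullCond P dP k' g}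

/-- `Ext^{k'+1}_A(Δ̄(i),Δ̄(i))`: chain maps modulo null-homotopic chain maps -/
abbrev extK := ↥(chainS K P dP k') ⧸
  (Submodule.comap (chainS K P dP k').subtype (nullS K P dP k'))

end ChainMaps

section RadicalMaps

variable {A : Type*} [Ring A] {M N L : Type*} [AddCommGroup M] [Module A M]
  [AddCommGroup N] [Module A N] [AddCommGroup L] [Module A L]

lemma map_mem_radM (f : M →ₗ[A] N) {x : M} (hx : x ∈ radM A M) : f x ∈ radM A N := by
  suffices radM A M ≤ (radM A N).comap f from this hx
  refine Submodule.span_le.2 ?_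
  rintro _ ⟨r, hr, m, rfl⟩
  exact Submodule.subset_span ⟨r, hr, f m, map_smul f r m⟩

lemma isRadHom_iff {f : M →ₗ[A] N} : IsRadHom A f ↔ ∀ x, f x ∈ radM A N := by
  simp [IsRadHom, SetLike.le_def]

lemma IsRadHom.comp_left {f : M →ₗ[A] N} (hf : IsRadHom A f) (g : N →ₗ[A] L) :
    IsRadHom A (g ∘ₗ f) :=
  isRadHom_iff.2 fun x => map_mem_radM g (isRadHom_iff.1 hf x)

lemma IsRadHom.comp_right {f : N →ₗ[A] L} (hf : IsRadHom A f) (g : M →ₗ[A] N) :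
    IsRadHom A (f ∘ₗ g) :=
  isRadHom_iff.2 fun x => isRadHom_iff.1 hf (g x)

lemma jacRad_eq_ringJacobson : jacRad A = Ring.jacobson A := by
  rw [← Ideal.jacobson_bot]
  simp [jacRad, Ideal.jacobson]

lemma mem_leftIdeal_iff {e y : A} (he : IsIdempotentElem e) :
    y ∈ leftIdeal A e ↔ y * e = y := by
  constructor
  · rintro ⟨z, rfl⟩
    change z * e * e = z * e
    rw [mul_assoc, he.eq]
  · exact fun h => ⟨y, h⟩

lemma radM_leftIdeal_ne_top {e : A} (he : IsIdempotentElem e) (h0 : e ≠ 0) :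
    radM A ↥(leftIdeal A e) ≠ ⊤ := by
  intro h
  have hle : radM A ↥(leftIdeal A e) ≤ Submodule.comap (leftIdeal A e).subtype (Ring.jacobson A) := by
    refine Submodule.span_le.2 ?_
    rintro _ ⟨r, hr, m, rfl⟩
    rw [jacRad_eq_ringJacobson] at hr
    exact Ideal.mul_mem_right (m : A) _ hr
  have he' : e ∈ Ring.jacobson A :=
    hle (h ▸ Submodule.mem_top : (⟨e, (mem_leftIdeal_iff he).2 he⟩ : ↥(leftIdeal A e)) ∈ _)
  rw [← Ideal.jacobson_bot, Ideal.mem_jacobson_iff] at he'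
  obtain ⟨z, hz⟩ := he' (-1)
  rw [Submodule.mem_bot] at hz
  have h2 : (z * -1 * e + z - 1) * e = 0 := by rw [hz, zero_mul]
  have h3 : (z * -1 * e + z - 1) * e = -(z * (e * e)) + z * e - e := by noncomm_ring
  rw [h3, he.eq] at h2
  simp at h2
  exact h0 h2

lemma leftIdeal_eq_top_of_mem {e : A} (he : IsIdempotentElem e)
    {N : Submodule A ↥(leftIdeal A e)}
    (h : (⟨e, (mem_leftIdeal_iff he).2 he⟩ : ↥(leftIdeal A e)) ∈ N) : N = ⊤ := by
  refine eq_top_iff.2 fun y _ => ?_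
  have : y = (y : A) • (⟨e, (mem_leftIdeal_iff he).2 he⟩ : ↥(leftIdeal A e)) :=
    Subtype.ext ((mem_leftIdeal_iff he).1 y.2).symm
  rw [this]
  exact N.smul_mem _ h

lemma IsPrimitiveIdem.eq_top_of_isCompl {e : A} (he : IsPrimitiveIdem A e)
    {N N' : Submodule A ↥(leftIdeal A e)} (h : IsCompl N N') : N = ⊤ ∨ N' = ⊤ := by
  obtain ⟨hi, -, hp⟩ := he
  set ε : ↥(leftIdeal A e) := ⟨e, (mem_leftIdeal_iff hi).2 hi⟩
  obtain ⟨y, hy, z, hz, hyz⟩ := Submodule.mem_sup.1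
    (h.sup_eq_top ▸ Submodule.mem_top : ε ∈ N ⊔ N')
  have key : ∀ w : ↥(leftIdeal A e), (w : A) • y + (w : A) • z = w := by
    intro w
    rw [← smul_add, hyz]
    exact Subtype.ext ((mem_leftIdeal_iff hi).1 w.2)
  have hy1 : (y : A) • z = y - (y : A) • y := eq_sub_of_add_eq' (key y)
  have hz1 : (z : A) • y = z - (z : A) • z := eq_sub_of_add_eq (key z)
  have hy2 : (y : A) • z = 0 := (Submodule.disjoint_def.1 h.disjoint) _
    (hy1 ▸ N.sub_mem hy (N.smul_mem _ hy)) (N'.smul_mem _ hz)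
  have hz2 : (z : A) • y = 0 := (Submodule.disjoint_def.1 h.disjoint) _
    (N.smul_mem _ hy) (hz1 ▸ N'.sub_mem hz (N'.smul_mem _ hz))
  rw [hy2] at hy1
  rw [hz2] at hz1
  have hyz' : e = y + z := (congrArg Subtype.val hyz).symm
  rcases hp y z (congrArg Subtype.val (sub_eq_zero.1 hy1.symm)).symm
    (congrArg Subtype.val (sub_eq_zero.1 hz1.symm)).symm
    (congrArg Subtype.val hy2) (congrArg Subtype.val hz2) hyz' with h0 | h0
  · right
    apply leftIdeal_eq_top_of_mem hi
    have : ε = z := Subtype.ext (by rw [← zero_add (z : A), ← h0]; exact hyz')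
    change ε ∈ N'
    rwa [this]
  · left
    apply leftIdeal_eq_top_of_mem hi
    have : ε = y := Subtype.ext (by rw [← add_zero (y : A), ← h0]; exact hyz')
    change ε ∈ N
    rwa [this]

/-- `Ae` is local for `e` primitive: a map to `Ae` that is not onto lands in the radical. -/
lemma IsPrimitiveIdem.isRadHom_of_not_surjective [IsArtinianRing A] {e : A}
    (he : IsPrimitiveIdem A e) (f : M →ₗ[A] ↥(leftIdeal A e))
    (hf : ¬ Function.Surjective f) : IsRadHom A f := by
  have hi := he.1
  refine isRadHom_iff.2 fun m => ?_
  suffices hJ : (f m : A) ∈ jacRad A by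
    refine Submodule.subset_span ⟨f m, hJ, ⟨e, (mem_leftIdeal_iff hi).2 hi⟩, ?_⟩
    exact Subtype.ext ((mem_leftIdeal_iff hi).1 (f m).2).symm
  rw [jacRad_eq_ringJacobson, ← Ideal.jacobson_bot, Ideal.mem_jacobson_iff]
  intro y
  set w := f (-y • m) with hw
  have hwv : (w : A) = -y * f m := by rw [hw, map_smul]; rfl
  let φ : ↥(leftIdeal A e) →ₗ[A] ↥(leftIdeal A e) :=
    (LinearMap.toSpanSingleton A _ w) ∘ₗ (leftIdeal A e).subtype
  have hφ : ∀ x, φ x = (x : A) • w := fun _ => rfl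
  have hφs : ¬ Function.Surjective φ := by
    intro hs
    refine hf fun x => ?_
    obtain ⟨z, rfl⟩ := hs x
    exact ⟨(z : A) • (-y • m), by rw [map_smul]; rfl⟩
  obtain ⟨N, hN⟩ := (φ.eventually_isCompl_ker_pow_range_pow).exists_forall_of_atTop
  have hpow : φ ^ (N + 1) = 0 := by
    rcases he.eq_top_of_isCompl (hN (N + 1) N.le_succ) with h | h
    · exact LinearMap.ker_eq_top.1 h
    · refine absurd (fun x => ?_) hφs
      obtain ⟨z, hz⟩ := LinearMap.range_eq_top.1 h x
      exact ⟨(φ ^ N) z, by rw [← hz, pow_succ']; rfl⟩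
  have hφp : ∀ r x, ((φ ^ r) x : A) = x * (w : A) ^ r := by
    intro r
    induction r with
    | zero => simp
    | succ r ih =>
      intro x
      rw [pow_succ', pow_succ, ← mul_assoc, ← ih]
      rfl
  have hnil : IsNilpotent (w : A) := by
    refine ⟨N + 2, ?_⟩
    rw [pow_succ', ← hφp, hpow]
    rfl
  obtain ⟨u, hu⟩ := hnil.isUnit_one_sub
  refine ⟨↑u⁻¹, ?_⟩
  have h1 : (↑u⁻¹ : A) * (1 - w) = 1 := by rw [← hu]; exact u.inv_mul
  rw [hwv] at h1
  rw [Submodule.mem_bot, ← h1]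
  noncomm_ring

lemma properU_ne_top {n : ℕ} {e : Fin n → A} {i : Fin n} (he : IsPrimitiveIdem A (e i)) :
    properU A e i ≠ ⊤ := fun h =>
  radM_leftIdeal_ne_top he.1 he.2.1 (eq_top_iff.2 (h ▸ by
    simp only [properU, iSup_le_iff]
    exact fun _ _ _ h => h))

lemma range_le_properU {n : ℕ} {e : Fin n → A} {i j : Fin n} (hij : i ≤ j)
    {φ : ↥(leftIdeal A (e j)) →ₗ[A] ↥(leftIdeal A (e i))} (hφ : IsRadHom A φ) :
    LinearMap.range φ ≤ properU A e i :=
  le_iSup_of_le j <| le_iSup_of_le hij <| le_iSup_of_le φ <| le_iSup_of_le hφ le_rfl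

/-- Radical maps from sums of `P(j)`, `j ≥ i`, to a projective module vanish after composition
with any map to the properly standard module. -/
lemma comp_eq_zero_of_isRadHom [Module.Projective A N] {n : ℕ} {e : Fin n → A} {i : Fin n}
    (π : N →ₗ[A] PStd A e i) {m : ℕ} {js : Fin m → Fin n} (hjs : ∀ t, i ≤ js t)
    (θ : M ≃ₗ[A] ((t : Fin m) → ↥(leftIdeal A (e (js t))))) {f : M →ₗ[A] N}
    (hf : IsRadHom A f) : π ∘ₗ f = 0 := by
  obtain ⟨σ, hσ⟩ := Module.projective_lifting_property (properU A e i).mkQ π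
    (Submodule.mkQ_surjective _)
  suffices h : (π ∘ₗ f) ∘ₗ θ.symm.toLinearMap = 0 by
    ext x
    simpa using LinearMap.congr_fun h (θ x)
  refine LinearMap.pi_ext' fun t => LinearMap.ext fun x => ?_
  have := range_le_properU (hjs t) (((hf.comp_left σ).comp_right θ.symm.toLinearMap).comp_right
    (LinearMap.single A (fun t => ↥(leftIdeal A (e (js t)))) t)) ⟨x, rfl⟩
  rw [← hσ]
  exact (Submodule.Quotient.mk_eq_zero _).2 this

/-- A map onto a projective module exhibits it as a direct summand. -/
lemma exists_isCompl_of_surjective [Module.Projective A N] (f : M →ₗ[A] N)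
    (hf : Function.Surjective f) :
    ∃ L L' : Submodule A M, IsCompl L L' ∧ Nonempty (↥L ≃ₗ[A] N) := by
  obtain ⟨s, hs⟩ := Module.projective_lifting_property f LinearMap.id hf
  have hs' : ∀ x, f (s x) = x := LinearMap.congr_fun hs
  refine ⟨LinearMap.range s, LinearMap.ker f, ⟨?_, ?_⟩,
    ⟨(LinearEquiv.ofInjective s (Function.LeftInverse.injective hs')).symm⟩⟩
  · rw [Submodule.disjoint_def]
    rintro _ ⟨x, rfl⟩ hx
    rw [LinearMap.mem_ker, hs'] at hx
    rw [hx, map_zero]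
  · rw [codisjoint_iff, eq_top_iff]
    intro x _
    refine Submodule.mem_sup.2 ⟨s (f x), ⟨_, rfl⟩, x - s (f x), ?_, by abel⟩
    simp [hs']

lemma exists_comp_eq_of_range_le [Module.Projective A M] (f : N →ₗ[A] L) (g : M →ₗ[A] L)
    (h : LinearMap.range g ≤ LinearMap.range f) : ∃ s : M →ₗ[A] N, f ∘ₗ s = g := by
  obtain ⟨s, hs⟩ := Module.projective_lifting_property f.rangeRestrict
    (g.codRestrict (LinearMap.range f) fun x => h ⟨x, rfl⟩) f.surjective_rangeRestrict
  exact ⟨s, LinearMap.ext fun x => congrArg Subtype.val (LinearMap.congr_fun hs x)⟩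

/-- Over an algebraically closed field, every endomorphism of a finite module differs from
a scalar by a map that is not onto. -/
lemma exists_sub_smul_not_surjective (K : Type*) [Field K] [IsAlgClosed K] [Algebra K A]
    [FiniteDimensional K A] [Module K M] [IsScalarTower K A M] [SMulCommClass A K M]
    [Module.Finite A M] [Nontrivial M] (φ : M →ₗ[A] M) :
    ∃ a : K, ¬ Function.Surjective (φ - a • (LinearMap.id : M →ₗ[A] M)) := by
  have : FiniteDimensional K M := Module.Finite.trans A M
  obtain ⟨a, ha⟩ := Module.End.exists_eigenvalue (K := K) (φ.restrictScalars K)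
  obtain ⟨v, hv⟩ := ha.exists_hasEigenvector
  refine ⟨a, fun hs => hv.2 ?_⟩
  have hi : Function.Injective
      ((φ - a • (LinearMap.id : M →ₗ[A] M)).restrictScalars K) :=
    LinearMap.injective_iff_surjective.2 hs
  apply hi
  have := hv.apply_eq_smul
  simp only [LinearMap.coe_restrictScalars] at this
  simp [this]

end RadicalMaps

lemma exists_seq_of_step {X : ℕ → Type*} (C : ∀ m, X m → Prop) (R : ∀ m, X m → X (m + 1) → Prop)
    (x₀ : X 0) (h₀ : C 0 x₀) (step : ∀ m x, C m x → ∃ y, R m x y ∧ C (m + 1) y) :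
    ∃ f : ∀ m, X m, f 0 = x₀ ∧ ∀ m, R m (f m) (f (m + 1)) := by
  choose F hR hC using step
  let G : ∀ m, {x : X m // C m x} := fun m =>
    Nat.rec ⟨x₀, h₀⟩ (fun m x => ⟨F m x.1 x.2, hC m x.1 x.2⟩) m
  exact ⟨fun m => (G m).1, rfl, fun m => hR m _ (G m).2⟩

section ChainMapSpaces

variable {A : Type*} [Ring A] {K : Type*} [Field K] [Algebra K A]
  {P : ℕ → Type*} [∀ l, AddCommGroup (P l)] [∀ l, Module A (P l)]
  [∀ l, Module K (P l)] [∀ l, IsScalarTower K A (P l)] [∀ l, SMulCommClass A K (P l)]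
  {dP : ∀ l, P (l + 1) →ₗ[A] P l} {k' : ℕ}

lemma map_smul_field {M N : Type*} [AddCommGroup M] [Module A M] [Module K M]
    [IsScalarTower K A M] [AddCommGroup N] [Module A N] [Module K N] [IsScalarTower K A N]
    (f : M →ₗ[A] N) (a : K) (x : M) : f (a • x) = a • f x :=
  f.map_smul_of_tower a x

lemma chainCond_of_mem_chainS {g : ∀ m, P (k' + m + 1) →ₗ[A] P m}
    (hg : g ∈ chainS K P dP k') : chainCond P dP k' g := by
  induction hg using Submodule.span_induction with
  | mem x h => exact h
  | zero => intro m; simp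
  | add x y _ _ hx hy =>
    intro m
    have h1 := hx m
    have h2 := hy m
    simp only [Pi.add_apply, LinearMap.add_comp, LinearMap.comp_add, smul_add, h1, h2]
  | smul a x _ hx =>
    intro m
    ext y
    have h1 := LinearMap.congr_fun (hx m) y
    simp only [LinearMap.comp_apply, LinearMap.smul_apply, Pi.smul_apply] at h1 ⊢
    rw [h1, map_smul_field, smul_comm]

lemma nullCond_of_mem_nullS {g : ∀ m, P (k' + m + 1) →ₗ[A] P m}
    (hg : g ∈ nullS K P dP k') : nullCond P dP k' g := by
  induction hg using Submodule.span_induction with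
  | mem x h => exact h
  | zero => exact ⟨0, fun m => by simp⟩
  | add x y _ _ hx hy =>
    obtain ⟨h, hh⟩ := hx
    obtain ⟨h', hh'⟩ := hy
    refine ⟨h + h', fun m => ?_⟩
    simp only [Pi.add_apply, LinearMap.add_comp, LinearMap.comp_add, smul_add, hh, hh']
    abel
  | smul a x _ hx =>
    obtain ⟨h, hh⟩ := hx
    refine ⟨a • h, fun m => ?_⟩
    ext y
    have h1 := LinearMap.congr_fun (hh m) y
    simp only [LinearMap.comp_apply, LinearMap.smul_apply, Pi.smul_apply,
      LinearMap.sub_apply] at h1 ⊢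
    rw [h1, map_smul_field, smul_sub, smul_comm a]

/-- The comparison theorem: a map in the lowest degree lifts to a chain map. -/
lemma exists_chainCond [∀ l, Module.Projective A (P l)]
    (hex : ∀ l, Function.Exact (dP (l + 1)) (dP l)) (g₀ : P (k' + 0 + 1) →ₗ[A] P 0)
    (h₀ : LinearMap.range (g₀ ∘ₗ dP (k' + 0 + 1)) ≤ LinearMap.range (dP 0)) :
    ∃ g : ∀ m, P (k' + m + 1) →ₗ[A] P m, chainCond P dP k' g ∧ g 0 = g₀ := by
  obtain ⟨g, hg0, hg⟩ := exists_seq_of_step (X := fun m => P (k' + m + 1) →ₗ[A] P m)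
    (fun m g => LinearMap.range (g ∘ₗ dP (k' + m + 1)) ≤ LinearMap.range (dP m))
    (fun m g g' => g ∘ₗ dP (k' + m + 1) = ((-1 : ℤ) ^ (k' + 1)) • (dP m ∘ₗ g')) g₀ h₀
    (by
      intro m g hg
      obtain ⟨s, hs⟩ := exists_comp_eq_of_range_le _ _ hg
      have hsq : ((-1 : ℤ) ^ (k' + 1)) * (-1) ^ (k' + 1) = 1 := by
        rw [← mul_pow]; simp
      refine ⟨((-1 : ℤ) ^ (k' + 1)) • s, ?_, ?_⟩
      · rw [LinearMap.comp_smul, smul_smul, hsq, one_smul, hs]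
      · rintro _ ⟨y, rfl⟩
        refine (hex m _).1 ?_
        have h1 := LinearMap.congr_fun hs (dP (k' + m + 1 + 1) y)
        have h2 : dP (k' + m + 1) (dP (k' + m + 1 + 1) y) = 0 :=
          (hex _).apply_apply_eq_zero y
        simp only [LinearMap.comp_apply] at h1
        rw [h2, map_zero] at h1
        change dP m ((((-1 : ℤ) ^ (k' + 1)) • s) (dP (k' + m + 1 + 1) y)) = 0
        rw [LinearMap.smul_apply, map_zsmul, h1, smul_zero])
  exact ⟨g, hg, hg0⟩

/-- A chain map whose lowest component lands in the image of the differential is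
null-homotopic. -/
lemma nullCond_of_range_le [∀ l, Module.Projective A (P l)]
    (hex : ∀ l, Function.Exact (dP (l + 1)) (dP l)) {g : ∀ m, P (k' + m + 1) →ₗ[A] P m}
    (hg : chainCond P dP k' g) (h₀ : LinearMap.range (g 0) ≤ LinearMap.range (dP 0)) :
    nullCond P dP k' g := by
  obtain ⟨h, -, hh⟩ := exists_seq_of_step (X := fun m => P (k' + m) →ₗ[A] P m)
    (fun m h => LinearMap.range (g m + ((-1 : ℤ) ^ k') • (h ∘ₗ dP (k' + m))) ≤
      LinearMap.range (dP m))
    (fun m h h' => (dP m ∘ₗ h' : P (k' + m + 1) →ₗ[A] P m) =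
      g m + ((-1 : ℤ) ^ k') • (h ∘ₗ dP (k' + m))) 0 (by simpa using h₀)
    (by
      intro m h hm
      obtain ⟨s, hs⟩ := exists_comp_eq_of_range_le _ _ hm
      refine ⟨s, hs, ?_⟩
      rintro _ ⟨y, rfl⟩
      refine (hex m _).1 ?_
      have h1 := LinearMap.congr_fun hs (dP (k' + m + 1) y)
      have h2 : dP (k' + m) (dP (k' + m + 1) y) = 0 := (hex _).apply_apply_eq_zero y
      have h3 := LinearMap.congr_fun (hg m) y
      simp only [LinearMap.comp_apply, LinearMap.add_apply, LinearMap.smul_apply] at h1 h3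
      rw [h2, map_zero, smul_zero, add_zero] at h1
      change dP m (g (m + 1) y + ((-1 : ℤ) ^ k') • s (dP (k' + m + 1) y)) = 0
      rw [map_add, map_zsmul, h1, h3, smul_smul, pow_succ, ← mul_assoc, ← mul_pow]
      simp)
  refine ⟨h, fun m => ?_⟩
  rw [hh m]
  abel

end ChainMapSpaces

theorem stmt4
    {K : Type u} [Field K] [IsAlgClosed K]
    {A : Type u} [Ring A] [Algebra K A] [FiniteDimensional K A]
    (n : ℕ) (e : Fin n → A)
    (hidem : ∀ i, IsPrimitiveIdem A (e i))
    (horth : ∀ i j, i ≠ j → e i * e j = 0)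
    (hcomplete : ∑ i, e i = 1)
    (i : Fin n)
    -- `P•` is a projective resolution of `Δ̄(i)` …
    (P : ℕ → Type u) [∀ l, AddCommGroup (P l)] [∀ l, Module A (P l)]
    [∀ l, Module K (P l)] [∀ l, IsScalarTower K A (P l)] [∀ l, SMulCommClass A K (P l)]
    (hproj : ∀ l, Module.Projective A (P l))
    (dP : ∀ l, P (l + 1) →ₗ[A] P l)
    (π : P 0 →ₗ[A] PStd A e i)
    (hπ : Function.Surjective π)
    (hex0 : Function.Exact (dP 0) π)
    (hex : ∀ l, Function.Exact (dP (l + 1)) (dP l))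
    -- … with `P_0 ≅ P(i)` …
    (e0 : P 0 ≃ₗ[A] ↥(leftIdeal A (e i)))
    -- … each `P_k`, `k ≥ 1`, a finite direct sum of modules `P(j)` with `j ≥ i` …
    (hPk : ∀ k : ℕ, ∃ (m : ℕ) (js : Fin m → Fin n), (∀ t, i ≤ js t) ∧
      Nonempty (P (k + 1) ≃ₗ[A] ((t : Fin m) → ↥(leftIdeal A (e (js t))))))
    -- … and all differentials radical maps (minimal resolution)
    (hrad : ∀ l, IsRadHom A (dP l))
    -- the degree `k = k' + 1 ≥ 1`
    (k' : ℕ)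
    -- `P_k ≅ P(i)^{⊕ c} ⊕ Q`, where `Q` has no direct summand isomorphic to `P(i)`
    (c : ℕ) (Q : Type u) [AddCommGroup Q] [Module A Q]
    (ephi : P (k' + 0 + 1) ≃ₗ[A] ((Fin c → ↥(leftIdeal A (e i))) × Q))
    (hQ : ¬ ∃ (N N' : Submodule A Q), IsCompl N N' ∧
      Nonempty (↥N ≃ₗ[A] ↥(leftIdeal A (e i)))) :
    -- conclusion: there are chain maps `f_1, …, f_c` with `f_l^{(k)} = [π_l, 0]`, whose
    -- classes form a `K`-basis of `Ext^k_A(Δ̄(i),Δ̄(i))`; in particular its dimension is `c`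
    ∃ (f : Fin c → ∀ m, P (k' + m + 1) →ₗ[A] P m)
      (hf : ∀ l, chainCond P dP k' (f l)),
      (∀ l : Fin c, f l 0 =
        (e0.symm.toLinearMap ∘ₗ (LinearMap.proj l) ∘ₗ
          (LinearMap.fst A (Fin c → ↥(leftIdeal A (e i))) Q) ∘ₗ ephi.toLinearMap)) ∧
      LinearIndependent K (fun l : Fin c =>
        (Submodule.Quotient.mk
          (⟨f l, Submodule.subset_span (hf l)⟩ : ↥(chainS K P dP k')) : extK K P dP k')) ∧
      Submodule.span K (Set.range (fun l : Fin c =>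
        (Submodule.Quotient.mk
          (⟨f l, Submodule.subset_span (hf l)⟩ : ↥(chainS K P dP k')) : extK K P dP k'))) = ⊤ ∧
      Module.finrank K (extK K P dP k') = c := by
  have hart : IsArtinianRing A := isArtinian_of_tower K inferInstance
  have hfin : Module.Finite A (P 0) := by
    have : Module.Finite A ↥(leftIdeal A (e i)) :=
      Module.Finite.of_surjective (mulRightLin A (e i)).rangeRestrict
        (mulRightLin A (e i)).surjective_rangeRestrict
    exact Module.Finite.equiv e0.symm
  have hntr : Nontrivial (PStd A e i) :=
    Submodule.Quotient.nontrivial_iff.2 (properU_ne_top (hidem i))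
  have : Nontrivial (P 0) := hπ.nontrivial
  have hπrad : ∀ {l} (f : P (l + 1) →ₗ[A] P 0), IsRadHom A f → π ∘ₗ f = 0 := by
    intro l f hf
    obtain ⟨m, js, hjs, ⟨θ⟩⟩ := hPk l
    exact comp_eq_zero_of_isRadHom π hjs θ hf
  have hrange : ∀ {l} (f : P (l + 1) →ₗ[A] P 0), π ∘ₗ f = 0 →
      LinearMap.range f ≤ LinearMap.range (dP 0) := by
    rintro l f hf _ ⟨x, rfl⟩
    exact (hex0 _).1 (LinearMap.congr_fun hf x)
  have hloc : ∀ {M : Type u} [AddCommGroup M] [Module A M] (f : M →ₗ[A] P 0),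
      ¬ Function.Surjective f → IsRadHom A f := by
    intro M _ _ f hf
    have h1 := (hidem i).isRadHom_of_not_surjective (e0.toLinearMap ∘ₗ f) fun hs => hf fun x => by
      obtain ⟨y, hy⟩ := hs (e0 x)
      exact ⟨y, e0.injective hy⟩
    have h2 := h1.comp_left e0.symm.toLinearMap
    rwa [← LinearMap.comp_assoc, LinearEquiv.symm_comp, LinearMap.id_comp] at h2
  have hnull : ∀ g, chainCond P dP k' g → (nullCond P dP k' g ↔ π ∘ₗ g 0 = 0) := by
    refine fun g hg => ⟨?_, fun h => nullCond_of_range_le hex hg (hrange _ h)⟩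
    rintro ⟨h, hh⟩
    have h1 : π ∘ₗ (h 0 ∘ₗ dP (k' + 0)) = 0 := hπrad _ ((hrad _).comp_left _)
    have h2 : π ∘ₗ dP 0 = 0 := hex0.linearMap_comp_eq_zero
    rw [hh 0, LinearMap.comp_sub, LinearMap.comp_smul, h1, ← LinearMap.comp_assoc, h2]
    simp
  let F : Fin c → P (k' + 0 + 1) →ₗ[A] P 0 := fun l =>
    e0.symm.toLinearMap ∘ₗ (LinearMap.proj l) ∘ₗ
      (LinearMap.fst A (Fin c → ↥(leftIdeal A (e i))) Q) ∘ₗ ephi.toLinearMap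
  have hlift : ∀ l, ∃ g, chainCond P dP k' g ∧ g 0 = F l := fun l =>
    exists_chainCond hex (F l) (hrange _ (hπrad _ ((hrad _).comp_left _)))
  choose f hf hf0 using hlift
  let ι : Fin c → P 0 →ₗ[A] P (k' + 0 + 1) := fun l =>
    ephi.symm.toLinearMap ∘ₗ (LinearMap.inl A _ Q) ∘ₗ
      (LinearMap.single A (fun _ => ↥(leftIdeal A (e i))) l) ∘ₗ e0.toLinearMap
  have hFι : ∀ l l' x, F l (ι l' x) = if l = l' then x else 0 := by
    intro l l' x
    by_cases h : l = l'
    · subst h; simp [F, ι]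
    · simp [F, ι, h]
  have hsum0 : ∀ a : Fin c → K, (∑ l, a l • f l) 0 = ∑ l, a l • F l := by
    intro a
    simp [Finset.sum_apply, hf0]
  have hsumι : ∀ (a : Fin c → K) l x, (∑ l, a l • F l) (ι l x) = a l • x := by
    intro a l x
    simp [LinearMap.sum_apply, hFι]
  have hsumChain : ∀ a : Fin c → K, ∑ l, a l • f l ∈ chainS K P dP k' := fun a =>
    Submodule.sum_mem _ fun l _ => Submodule.smul_mem _ _ (Submodule.subset_span (hf l))
  have hmk : ∀ a : Fin c → K, ∑ l, a l • (Submodule.Quotient.mk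
      (⟨f l, Submodule.subset_span (hf l)⟩ : ↥(chainS K P dP k')) : extK K P dP k') =
      Submodule.Quotient.mk ⟨∑ l, a l • f l, hsumChain a⟩ := by
    intro a
    have h1 : (⟨∑ l, a l • f l, hsumChain a⟩ : ↥(chainS K P dP k')) =
        ∑ l, a l • ⟨f l, Submodule.subset_span (hf l)⟩ :=
      Subtype.ext (by simp only [Submodule.coe_sum, Submodule.coe_smul])
    rw [h1, ← Submodule.mkQ_apply, map_sum]
    rfl
  have hli : LinearIndependent K (fun l : Fin c =>
      (Submodule.Quotient.mk
        (⟨f l, Submodule.subset_span (hf l)⟩ : ↥(chainS K P dP k')) : extK K P dP k')) := by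
    rw [Fintype.linearIndependent_iff]
    intro a ha l
    rw [hmk, Submodule.Quotient.mk_eq_zero] at ha
    have h1 := (hnull _ (chainCond_of_mem_chainS (hsumChain a))).1 (nullCond_of_mem_nullS ha)
    rw [hsum0] at h1
    by_contra hne
    obtain ⟨z, hz⟩ := exists_ne (0 : PStd A e i)
    obtain ⟨y, rfl⟩ := hπ z
    have h2 := LinearMap.congr_fun h1 (ι l ((a l)⁻¹ • y))
    rw [LinearMap.comp_apply, hsumι, smul_smul, mul_inv_cancel₀ hne, one_smul] at h2
    exact hz h2
  have hspan : Submodule.span K (Set.range (fun l : Fin c =>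
      (Submodule.Quotient.mk
        (⟨f l, Submodule.subset_span (hf l)⟩ : ↥(chainS K P dP k')) : extK K P dP k'))) = ⊤ := by
    refine eq_top_iff.2 fun q _ => ?_
    obtain ⟨⟨g, hg⟩, rfl⟩ := Submodule.Quotient.mk_surjective _ q
    choose a ha using fun l => exists_sub_smul_not_surjective K (g 0 ∘ₗ ι l)
    have hd := Submodule.sub_mem _ hg (hsumChain a)
    set r : P (k' + 0 + 1) →ₗ[A] P 0 := g 0 - ∑ l, a l • F l with hr
    have hr1 : ∀ l, IsRadHom A (r ∘ₗ ι l) := by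
      intro l
      apply hloc
      convert ha l using 2
      ext x
      simp only [hr, LinearMap.comp_apply, LinearMap.sub_apply, hsumι]
      rfl
    have hr2 : IsRadHom A (r ∘ₗ ephi.symm.toLinearMap ∘ₗ LinearMap.inr A _ Q) :=
      hloc _ fun hs => hQ <| by
        obtain ⟨N, N', hc, ⟨ε⟩⟩ := exists_isCompl_of_surjective _ hs
        exact ⟨N, N', hc, ⟨ε.trans e0⟩⟩
    have hrr : IsRadHom A r := by
      refine isRadHom_iff.2 fun x => ?_
      have hx : x = ∑ l, ι l (e0.symm ((ephi x).1 l)) +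
          ephi.symm (LinearMap.inr A _ Q (ephi x).2) := by
        apply ephi.injective
        simp only [map_add, map_sum]
        ext1
        · ext l
          simp [ι, Prod.fst_sum, Finset.sum_apply]
        · simp [ι, Prod.snd_sum]
      rw [hx, map_add, map_sum]
      exact Submodule.add_mem _ (Submodule.sum_mem _ fun l _ => isRadHom_iff.1 (hr1 l) _)
        (isRadHom_iff.1 hr2 _)
    have hnc : nullCond P dP k' (g - ∑ l, a l • f l) := by
      refine (hnull _ (chainCond_of_mem_chainS hd)).2 ?_
      rw [Pi.sub_apply, hsum0]
      exact hπrad r hrr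
    have hq : (Submodule.Quotient.mk ⟨g, hg⟩ : extK K P dP k') =
        Submodule.Quotient.mk ⟨∑ l, a l • f l, hsumChain a⟩ :=
      (Submodule.Quotient.eq _).2 (Submodule.subset_span hnc)
    rw [hq, ← hmk]
    exact Submodule.sum_mem _ fun l _ =>
      Submodule.smul_mem _ _ (Submodule.subset_span ⟨l, rfl⟩)
  refine ⟨f, hf, hf0, hli, hspan, ?_⟩
  rw [Module.finrank_eq_card_basis (Module.Basis.mk hli hspan.ge), Fintype.card_fin]

end
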